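/- Let 𝔛₁ and 𝔛₂ be compatible unital *-subalgebras of M_n(ℂ) and ρ a state on M_n(ℂ). Let σ be the unique state on the tensor product 𝔛₁⊗𝔛₂ satisfying (τ_{𝔛₁}⊗τ_{𝔛₂})(σ·(x₁⊗x₂)) = Tr(ρ x₁ x₂) for all x₁ ∈ 𝔛₁, x₂ ∈ 𝔛₂, and let σ₁, σ₂ be its marginals (partial traces) on 𝔛₁ and 𝔛₂. Then I_ρ(𝔛₁∧𝔛₂) = D(σ ‖ σ₁⊗σ₂); in particular I_ρ(𝔛₁∧𝔛₂) ≥ 0. -/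

import Mathlib

open scoped ComplexOrder Kronecker
open Matrix

noncomputable def negMulLogb (x : ℝ) : ℝ := -(x * Real.logb 2 x)

noncomputable def shannonEntropy {α : Type*} [Fintype α] (p : α → ℝ) : ℝ :=
  ∑ i, negMulLogb (p i)

noncomputable def mutualInfo {α β : Type*} [Fintype α] [Fintype β]
    (p : α → β → ℝ) : ℝ :=
  shannonEntropy (fun i => ∑ j, p i j) + shannonEntropy (fun j => ∑ i, p i j)
    - shannonEntropy (fun ij : α × β => p ij.1 ij.2)

noncomputable def binEnt (t : ℝ) : ℝ := negMulLogb t + negMulLogb (1 - t)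

noncomputable def vnEntropy {α : Type*} [Fintype α] [DecidableEq α]
    (ρ : Matrix α α ℂ) : ℝ :=
  if h : ρ.IsHermitian then ∑ i, negMulLogb (h.eigenvalues i) else 0

noncomputable def matLogb {α : Type*} [Fintype α] [DecidableEq α]
    (A : Matrix α α ℂ) : Matrix α α ℂ :=
  if h : A.IsHermitian then
    (h.eigenvectorUnitary : Matrix α α ℂ) *
      Matrix.diagonal (fun i => (Real.logb 2 (h.eigenvalues i) : ℂ)) *
      star (h.eigenvectorUnitary : Matrix α α ℂ)
  else 0

def MatState {α : Type*} [Fintype α] [DecidableEq α] (ρ : Matrix α α ℂ) : Prop :=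
  ρ.PosSemidef ∧ ρ.trace = 1

def IsProjn {α : Type*} [Fintype α] [DecidableEq α] (p : Matrix α α ℂ) : Prop :=
  p.IsHermitian ∧ p * p = p

def IsMinProjOf {α : Type*} [Fintype α] [DecidableEq α]
    (X : StarSubalgebra ℂ (Matrix α α ℂ)) (p : Matrix α α ℂ) : Prop :=
  p ∈ X ∧ IsProjn p ∧ p ≠ 0 ∧
    ∀ q ∈ X, IsProjn q → q * p = q → q = 0 ∨ q = p

def IsCanonicalTrace {α : Type*} [Fintype α] [DecidableEq α]
    (X : StarSubalgebra ℂ (Matrix α α ℂ)) (τ : Matrix α α ℂ →ₗ[ℂ] ℂ) : Prop :=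
  (∀ x ∈ X, ∀ y ∈ X, τ (x * y) = τ (y * x)) ∧
  (∀ x ∈ X, 0 ≤ τ (star x * x)) ∧
  (∀ p, IsMinProjOf X p → τ p = 1)

def IsRestriction {α : Type*} [Fintype α] [DecidableEq α]
    (X : StarSubalgebra ℂ (Matrix α α ℂ)) (τ : Matrix α α ℂ →ₗ[ℂ] ℂ)
    (ρ r : Matrix α α ℂ) : Prop :=
  r ∈ X ∧ r.PosSemidef ∧ ∀ x ∈ X, τ (r * x) = (ρ * x).trace

noncomputable def algEntropy {α : Type*} [Fintype α] [DecidableEq α]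
    (τ : Matrix α α ℂ →ₗ[ℂ] ℂ) (r : Matrix α α ℂ) : ℝ :=
  -(τ (r * matLogb r)).re

def IsAlgEntropy {α : Type*} [Fintype α] [DecidableEq α]
    (X : StarSubalgebra ℂ (Matrix α α ℂ)) (ρ : Matrix α α ℂ) (H : ℝ) : Prop :=
  ∃ τ r, IsCanonicalTrace X τ ∧ IsRestriction X τ ρ r ∧ H = algEntropy τ r

def CompatibleAlg {α : Type*} [Fintype α] [DecidableEq α]
    (X Y : StarSubalgebra ℂ (Matrix α α ℂ)) : Prop :=
  ∀ x ∈ X, ∀ y ∈ Y, x * y = y * x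

section FunctionalCalculus

variable {α : Type*} [Fintype α] [DecidableEq α]

/-- The functional calculus of a Hermitian matrix. -/
noncomputable def hermCalc {A : Matrix α α ℂ} (h : A.IsHermitian) (f : ℝ → ℝ) : Matrix α α ℂ :=
  (h.eigenvectorUnitary : Matrix α α ℂ) * diagonal (fun i => (f (h.eigenvalues i) : ℂ)) *
    star (h.eigenvectorUnitary : Matrix α α ℂ)

lemma matLogb_eq_hermCalc {A : Matrix α α ℂ} (h : A.IsHermitian) :
    matLogb A = hermCalc h (Real.logb 2) := by
  rw [matLogb, dif_pos h, hermCalc]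

lemma aeval_conj_diagonal {V : Matrix α α ℂ} (hV : star V * V = 1) (hV' : V * star V = 1)
    (d : α → ℂ) (p : Polynomial ℂ) :
    Polynomial.aeval (V * diagonal d * star V) p =
      V * diagonal (fun i => p.eval (d i)) * star V := by
  induction p using Polynomial.induction_on' with
  | add p q hp hq =>
    rw [map_add, hp, hq, ← add_mul, ← mul_add, diagonal_add]
    simp
  | monomial k a =>
    have hpow : (V * diagonal d * star V) ^ k = V * diagonal (fun i => d i ^ k) * star V := by
      induction k with
      | zero => simp [hV']
      | succ k ih =>
        rw [pow_succ, ih]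
        calc _ = V * diagonal (fun i => d i ^ k) * (star V * V) * diagonal d * star V := by
              simp only [mul_assoc]
          _ = _ := by rw [hV, mul_one, mul_assoc V, diagonal_mul_diagonal]; simp [pow_succ]
    rw [Polynomial.aeval_monomial, hpow, ← Algebra.smul_def]
    have : diagonal (fun i => (Polynomial.monomial k a).eval (d i)) =
        a • diagonal (fun i => d i ^ k) := by
      ext i j
      by_cases hij : i = j <;> simp [hij]
    rw [this]
    simp

lemma exists_polynomial_eval_eq (S : Finset ℝ) (f : ℝ → ℝ) :
    ∃ p : Polynomial ℂ, ∀ x ∈ S, p.eval (x : ℂ) = f x :=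
  ⟨Lagrange.interpolate S (fun x : ℝ => (x : ℂ)) (fun x => (f x : ℂ)), fun _ hx =>
    Lagrange.eval_interpolate_at_node _ (fun _ _ _ _ h => Complex.ofReal_injective h) hx⟩

variable {A : Matrix α α ℂ} (h : A.IsHermitian)

lemma star_mul_eigenvectorUnitary :
    star (h.eigenvectorUnitary : Matrix α α ℂ) * h.eigenvectorUnitary = 1 :=
  Unitary.coe_star_mul_self _

lemma eigenvectorUnitary_mul_star :
    (h.eigenvectorUnitary : Matrix α α ℂ) * star (h.eigenvectorUnitary : Matrix α α ℂ) = 1 :=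
  Unitary.coe_mul_star_self _

lemma hermCalc_id : hermCalc h (fun x => x) = A := by
  conv_rhs => rw [h.spectral_theorem]
  rfl

lemma hermCalc_eq_aeval {f : ℝ → ℝ} {p : Polynomial ℂ}
    (hp : ∀ i, p.eval (h.eigenvalues i : ℂ) = f (h.eigenvalues i)) :
    hermCalc h f = Polynomial.aeval A p := by
  have := aeval_conj_diagonal (star_mul_eigenvectorUnitary h) (eigenvectorUnitary_mul_star h)
    (fun i => (h.eigenvalues i : ℂ)) p
  simp only [hp] at this
  rw [hermCalc, ← this]
  exact congrArg (fun B => Polynomial.aeval B p) (hermCalc_id h)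

lemma hermCalc_eq_conj_diagonal {V : Matrix α α ℂ} (hV : star V * V = 1) (hV' : V * star V = 1)
    (d : α → ℝ) (hA : A = V * diagonal (fun i => (d i : ℂ)) * star V) (f : ℝ → ℝ) :
    hermCalc h f = V * diagonal (fun i => (f (d i) : ℂ)) * star V := by
  obtain ⟨p, hp⟩ := exists_polynomial_eval_eq
    (Finset.univ.image h.eigenvalues ∪ Finset.univ.image d) f
  rw [hermCalc_eq_aeval h (p := p) (fun i => hp _ (by simp)), hA, aeval_conj_diagonal hV hV']
  congr 3
  ext i
  exact hp _ (by simp)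

lemma hermCalc_mem {X : StarSubalgebra ℂ (Matrix α α ℂ)} (hA : A ∈ X) (f : ℝ → ℝ) :
    hermCalc h f ∈ X := by
  obtain ⟨p, hp⟩ := exists_polynomial_eval_eq (Finset.univ.image h.eigenvalues) f
  rw [hermCalc_eq_aeval h (p := p) (fun i => hp _ (by simp))]
  exact Algebra.adjoin_le (S := X.toSubalgebra) (Set.singleton_subset_iff.2 hA)
    (Polynomial.aeval_mem_adjoin_singleton ℂ A)

lemma hermCalc_mul (f g : ℝ → ℝ) :
    hermCalc h f * hermCalc h g = hermCalc h (fun x => f x * g x) := by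
  simp only [hermCalc]
  calc _ = (h.eigenvectorUnitary : Matrix α α ℂ) * diagonal (fun i => (f (h.eigenvalues i) : ℂ)) *
        (star (h.eigenvectorUnitary : Matrix α α ℂ) * h.eigenvectorUnitary) *
        diagonal (fun i => (g (h.eigenvalues i) : ℂ)) *
        star (h.eigenvectorUnitary : Matrix α α ℂ) := by simp only [mul_assoc]
    _ = _ := by
      rw [star_mul_eigenvectorUnitary, mul_one, mul_assoc (h.eigenvectorUnitary : Matrix α α ℂ),
        diagonal_mul_diagonal]
      simp

lemma hermCalc_one : hermCalc h (fun _ => 1) = 1 := by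
  simp [hermCalc]

lemma hermCalc_congr {f g : ℝ → ℝ} (hfg : ∀ i, f (h.eigenvalues i) = g (h.eigenvalues i)) :
    hermCalc h f = hermCalc h g := by
  simp only [hermCalc, hfg]

lemma isHermitian_hermCalc (f : ℝ → ℝ) : (hermCalc h f).IsHermitian := by
  rw [IsHermitian, hermCalc, star_eq_conjTranspose, conjTranspose_mul, conjTranspose_mul,
    conjTranspose_conjTranspose, diagonal_conjTranspose, mul_assoc]
  congr 3
  ext i
  simp

/-- The finite set of eigenvalues. -/
noncomputable def eigSet : Finset ℝ := Finset.univ.image h.eigenvalues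

/-- The spectral projection at a real number. -/
noncomputable def eigProj (x : ℝ) : Matrix α α ℂ := hermCalc h (fun t => if t = x then 1 else 0)

lemma eigProj_mem {X : StarSubalgebra ℂ (Matrix α α ℂ)} (hA : A ∈ X) (x : ℝ) :
    eigProj h x ∈ X :=
  hermCalc_mem h hA _

lemma hermCalc_eq_sum (f : ℝ → ℝ) :
    hermCalc h f = ∑ x ∈ eigSet h, (f x : ℂ) • eigProj h x := by
  simp only [eigProj, hermCalc]
  simp only [← smul_mul_assoc _ (_ * _), ← mul_smul_comm]
  rw [← Finset.sum_mul, ← Finset.mul_sum]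
  congr 2
  ext i j
  rw [Matrix.sum_apply]
  by_cases hij : i = j
  · subst hij
    rw [Finset.sum_eq_single (h.eigenvalues i)]
    · simp
    · intro x _ hx
      simp [hx.symm]
    · simp [eigSet]
  · simp [hij]

lemma isProjn_eigProj (x : ℝ) : IsProjn (eigProj h x) := by
  refine ⟨isHermitian_hermCalc h _, ?_⟩
  rw [eigProj, hermCalc_mul]
  exact hermCalc_congr h (fun i => by split_ifs <;> simp)

lemma mul_eigProj (x : ℝ) : A * eigProj h x = (x : ℂ) • eigProj h x := by
  calc A * eigProj h x = hermCalc h (fun t => t) * eigProj h x := by rw [hermCalc_id]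
    _ = (x : ℂ) • eigProj h x := ?_
  rw [eigProj, hermCalc_mul]
  simp only [hermCalc]
  rw [← smul_mul_assoc, ← mul_smul_comm]
  congr 2
  ext i j
  by_cases hij : i = j
  · subst hij
    by_cases hx : h.eigenvalues i = x <;> simp [hx]
  · simp [hij]

lemma eigSet_nonneg (hA : A.PosSemidef) {x : ℝ} (hx : x ∈ eigSet hA.isHermitian) : 0 ≤ x := by
  obtain ⟨i, -, rfl⟩ := Finset.mem_image.1 hx
  exact hA.eigenvalues_nonneg i

end FunctionalCalculus

section MinimalProjections

variable {α : Type*} [Fintype α] [DecidableEq α]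

lemma IsProjn.mul_comm_of_le {e q : Matrix α α ℂ} (he : IsProjn e) (hq : IsProjn q)
    (hqe : q * e = q) : e * q = q := by
  have := congrArg conjTranspose hqe
  rwa [conjTranspose_mul, he.1.eq, hq.1.eq] at this

lemma IsProjn.sub {e q : Matrix α α ℂ} (he : IsProjn e) (hq : IsProjn q) (hqe : q * e = q) :
    IsProjn (e - q) := by
  refine ⟨he.1.sub hq.1, ?_⟩
  rw [sub_mul, mul_sub, mul_sub, he.2, hq.2, hqe, he.mul_comm_of_le hq hqe]
  simp

lemma IsProjn.eq_star_mul {e : Matrix α α ℂ} (he : IsProjn e) : e = star e * e := by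
  rw [star_eq_conjTranspose, he.1.eq, he.2]

/-- Well-founded induction on the projections of a star subalgebra. -/
lemma projection_induction {X : StarSubalgebra ℂ (Matrix α α ℂ)} {P : Matrix α α ℂ → Prop}
    (step : ∀ e ∈ X, IsProjn e →
      (∀ q ∈ X, IsProjn q → q * e = q → q ≠ e → P q) → P e) :
    ∀ e ∈ X, IsProjn e → P e := by
  intro e
  induction hR : LinearMap.range e.mulVecLin using WellFoundedLT.induction generalizing e with
  | ind R ih =>
    subst hR
    intro heX he
    refine step e heX he fun q hqX hq hqe hne => ih _ ?_ q rfl hqX hq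
    have heq := he.mul_comm_of_le hq hqe
    refine lt_of_le_of_ne ?_ fun hrange => hne ?_
    · rintro _ ⟨v, rfl⟩
      exact ⟨q.mulVec v, by simp [mulVec_mulVec, heq]⟩
    · refine hqe.symm.trans (Matrix.mulVec_injective (funext fun v => ?_))
      obtain ⟨w, hw⟩ : e.mulVecLin v ∈ LinearMap.range q.mulVecLin := hrange ▸ ⟨v, rfl⟩
      simp only [mulVecLin_apply] at hw
      rw [← mulVec_mulVec, ← hw, mulVec_mulVec, hq.2]

lemma exists_minProj_le {X : StarSubalgebra ℂ (Matrix α α ℂ)} :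
    ∀ e ∈ X, IsProjn e → e ≠ 0 → ∃ p, IsMinProjOf X p ∧ p * e = p := by
  refine projection_induction fun e heX he ih he0 => ?_
  by_cases hmin : IsMinProjOf X e
  · exact ⟨e, hmin, he.2⟩
  · simp only [IsMinProjOf, not_and, not_forall, not_or] at hmin
    obtain ⟨q, hqX, hq, hqe, hq0, hne⟩ := hmin heX he he0
    obtain ⟨p, hp, hpq⟩ := ih q hqX hq hqe hne hq0
    exact ⟨p, hp, by rw [← hpq, mul_assoc, hqe]⟩

lemma IsMinProjOf.exists_eq_smul_of_isHermitian {X : StarSubalgebra ℂ (Matrix α α ℂ)}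
    {p A : Matrix α α ℂ} (hp : IsMinProjOf X p) (hA : A ∈ X) (h : A.IsHermitian)
    (hAp : A * p = A) : ∃ c : ℂ, A = c • p := by
  have hpA : p * A = A := by
    have := congrArg conjTranspose hAp
    rwa [conjTranspose_mul, hp.2.1.1.eq, h.eq] at this
  have key : ∀ x : ℝ, ∃ c : ℂ, (x : ℂ) • eigProj h x = c • p := by
    intro x
    by_cases hx : (x : ℂ) = 0
    · exact ⟨0, by simp [hx]⟩
    have hle : p * eigProj h x = eigProj h x := by
      apply smul_right_injective _ hx
      simp only
      rw [← mul_smul_comm, ← mul_eigProj, ← mul_assoc, hpA]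
    have hle' : eigProj h x * p = eigProj h x := by
      have := congrArg conjTranspose hle
      rwa [conjTranspose_mul, hp.2.1.1.eq, (isProjn_eigProj h x).1.eq] at this
    rcases hp.2.2.2 _ (eigProj_mem h hA x) (isProjn_eigProj h x) hle' with h0 | h1
    · exact ⟨0, by rw [h0]; simp⟩
    · exact ⟨x, by rw [h1]⟩
  choose c hc using key
  refine ⟨∑ x ∈ eigSet h, c x, ?_⟩
  rw [Finset.sum_smul, ← Finset.sum_congr rfl fun x _ => hc x, ← hermCalc_eq_sum h (fun x => x),
    hermCalc_id]

lemma IsMinProjOf.exists_corner_eq_smul {X : StarSubalgebra ℂ (Matrix α α ℂ)}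
    {p a : Matrix α α ℂ} (hp : IsMinProjOf X p) (ha : a ∈ X) : ∃ c : ℂ, p * a * p = c • p := by
  have hpX := hp.1
  have hpp := hp.2.1.2
  have herm : ∀ b ∈ X, b.IsHermitian → ∃ c : ℂ, p * b * p = c • p := by
    intro b hb hbh
    refine hp.exists_eq_smul_of_isHermitian (mul_mem (mul_mem hpX hb) hpX) ?_
      (by rw [mul_assoc, hpp])
    rw [IsHermitian, conjTranspose_mul, conjTranspose_mul, hp.2.1.1.eq, hbh.eq, mul_assoc]
  have hsa : star a ∈ X := star_mem ha
  obtain ⟨c, hc⟩ := herm (a + star a) (add_mem ha hsa) (by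
    rw [IsHermitian, star_eq_conjTranspose, conjTranspose_add, conjTranspose_conjTranspose,
      add_comm])
  obtain ⟨d, hd⟩ := herm (Complex.I • (a - star a)) (X.smul_mem (sub_mem ha hsa) _) (by
    rw [IsHermitian, star_eq_conjTranspose, conjTranspose_smul, conjTranspose_sub,
      conjTranspose_conjTranspose]
    simp [sub_eq_add_neg, add_comm])
  refine ⟨(c - Complex.I * d) / 2, ?_⟩
  have hdec : a = (1 / 2 : ℂ) • (a + star a) + (-Complex.I / 2) • (Complex.I • (a - star a)) := by
    rw [smul_smul, show -Complex.I / 2 * Complex.I = 1 / 2 by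
      rw [div_mul_eq_mul_div, neg_mul, Complex.I_mul_I]; norm_num, ← smul_add]
    simp [← two_smul ℂ, smul_smul]
  rw [hdec, mul_add, add_mul, mul_smul_comm, smul_mul_assoc, hc, mul_smul_comm, smul_mul_assoc,
    hd, smul_smul, smul_smul, ← add_smul]
  congr 1
  ring

end MinimalProjections

section CanonicalTrace

variable {α : Type*} [Fintype α] [DecidableEq α] {X : StarSubalgebra ℂ (Matrix α α ℂ)}
  {τ : Matrix α α ℂ →ₗ[ℂ] ℂ}

lemma IsCanonicalTrace.projn_nonneg (hτ : IsCanonicalTrace X τ) {e : Matrix α α ℂ} (he : e ∈ X)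
    (hp : IsProjn e) : 0 ≤ τ e := by
  rw [hp.eq_star_mul]
  exact hτ.2.1 e he

lemma IsCanonicalTrace.one_le (hτ : IsCanonicalTrace X τ) {e : Matrix α α ℂ} (he : e ∈ X)
    (hp : IsProjn e) (h0 : e ≠ 0) : 1 ≤ τ e := by
  obtain ⟨p, hpmin, hpe⟩ := exists_minProj_le e he hp h0
  have := hτ.projn_nonneg (sub_mem he hpmin.1) (hp.sub hpmin.2.1 hpe)
  rwa [map_sub, hτ.2.2 p hpmin, sub_nonneg] at this

lemma IsCanonicalTrace.eq_zero_of_posSemidef (hτ : IsCanonicalTrace X τ) {A : Matrix α α ℂ}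
    (hA : A ∈ X) (hpos : A.PosSemidef) (h0 : τ A = 0) : A = 0 := by
  have h := hpos.isHermitian
  have hsum : A = ∑ x ∈ eigSet h, (x : ℂ) • eigProj h x := by
    rw [← hermCalc_eq_sum h (fun x => x), hermCalc_id]
  have hnn : ∀ x ∈ eigSet h, 0 ≤ (x : ℂ) * τ (eigProj h x) := fun x hx =>
    mul_nonneg (by exact_mod_cast eigSet_nonneg hpos hx)
      (hτ.projn_nonneg (eigProj_mem h hA x) (isProjn_eigProj h x))
  have hz : ∑ x ∈ eigSet h, (x : ℂ) * τ (eigProj h x) = 0 := by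
    rw [← h0]
    conv_rhs => rw [hsum]
    simp
  rw [Finset.sum_eq_zero_iff_of_nonneg hnn] at hz
  rw [hsum]
  refine Finset.sum_eq_zero fun x hx => ?_
  rcases mul_eq_zero.1 (hz x hx) with hx0 | ht
  · rw [hx0, zero_smul]
  · by_cases he : eigProj h x = 0
    · rw [he, smul_zero]
    · have := hτ.one_le (eigProj_mem h hA x) (isProjn_eigProj h x) he
      rw [ht] at this
      exact absurd this (by norm_num)

lemma IsCanonicalTrace.faithful (hτ : IsCanonicalTrace X τ) {a : Matrix α α ℂ}
    (ha : a ∈ X) (h0 : τ (star a * a) = 0) : a = 0 := by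
  refine conjTranspose_mul_self_eq_zero.1 ?_
  exact hτ.eq_zero_of_posSemidef (mul_mem (star_mem ha) ha) (posSemidef_conjTranspose_mul_self a) h0

lemma IsCanonicalTrace.mul_projn_nonneg (hτ : IsCanonicalTrace X τ) {p q : Matrix α α ℂ}
    (hp : p ∈ X) (hq : q ∈ X) (hpp : IsProjn p) (hqp : IsProjn q) : 0 ≤ τ (p * q) := by
  have := hτ.2.1 (q * p) (mul_mem hq hp)
  rwa [star_eq_conjTranspose, conjTranspose_mul, hpp.1.eq, hqp.1.eq, mul_assoc, ← mul_assoc q,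
    hqp.2, hτ.1 p hp _ (mul_mem hq hp), mul_assoc, hpp.2, hτ.1 q hq p hp] at this

end CanonicalTrace

section Transfer

variable {α β : Type*} [Fintype α] [DecidableEq α] [Fintype β] [DecidableEq β]

/-- A linear map restricting to a surjective unital star homomorphism between star subalgebras. -/
structure IsStarSurjection (X : StarSubalgebra ℂ (Matrix α α ℂ))
    (Y : StarSubalgebra ℂ (Matrix β β ℂ)) (π : Matrix α α ℂ →ₗ[ℂ] Matrix β β ℂ) : Prop where
  maps : ∀ a ∈ X, π a ∈ Y
  surj : ∀ y ∈ Y, ∃ a ∈ X, π a = y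
  map_mul : ∀ a ∈ X, ∀ b ∈ X, π (a * b) = π a * π b
  map_star : ∀ a ∈ X, π (star a) = star (π a)
  map_one : π 1 = 1

variable {X : StarSubalgebra ℂ (Matrix α α ℂ)} {Y : StarSubalgebra ℂ (Matrix β β ℂ)}
  {π : Matrix α α ℂ →ₗ[ℂ] Matrix β β ℂ}
  {τ : Matrix α α ℂ →ₗ[ℂ] ℂ} {τ' : Matrix β β ℂ →ₗ[ℂ] ℂ}

lemma IsStarSurjection.id : IsStarSurjection X X LinearMap.id :=
  ⟨fun _ h => h, fun y hy => ⟨y, hy, rfl⟩, fun _ _ _ _ => rfl, fun _ _ => rfl, rfl⟩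

lemma IsStarSurjection.map_aeval (hπ : IsStarSurjection X Y π) {A : Matrix α α ℂ} (hA : A ∈ X)
    (p : Polynomial ℂ) : π (Polynomial.aeval A p) = Polynomial.aeval (π A) p := by
  induction p using Polynomial.induction_on' with
  | add p q hp hq => rw [_root_.map_add, _root_.map_add, hp, hq, _root_.map_add]
  | monomial k a =>
    have hpow : π (A ^ k) = π A ^ k := by
      induction k with
      | zero => simpa using hπ.map_one
      | succ k ih => rw [pow_succ, hπ.map_mul _ (pow_mem hA k) _ hA, ih, pow_succ]
    simp only [Polynomial.aeval_monomial, ← Algebra.smul_def]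
    rw [LinearMap.map_smul, hpow]

lemma IsStarSurjection.map_isHermitian (hπ : IsStarSurjection X Y π) {A : Matrix α α ℂ}
    (hA : A ∈ X) (h : A.IsHermitian) : (π A).IsHermitian := by
  rw [IsHermitian, ← star_eq_conjTranspose, ← hπ.map_star _ hA, star_eq_conjTranspose, h.eq]

lemma IsStarSurjection.map_isProjn (hπ : IsStarSurjection X Y π) {e : Matrix α α ℂ}
    (he : e ∈ X) (hp : IsProjn e) : IsProjn (π e) :=
  ⟨hπ.map_isHermitian he hp.1, by rw [← hπ.map_mul _ he _ he, hp.2]⟩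

lemma IsStarSurjection.map_matLogb (hπ : IsStarSurjection X Y π) {A : Matrix α α ℂ}
    (hA : A ∈ X) (h : A.IsHermitian) : π (matLogb A) = matLogb (π A) := by
  have h' := hπ.map_isHermitian hA h
  obtain ⟨p, hp⟩ := exists_polynomial_eval_eq (eigSet h ∪ eigSet h') (Real.logb 2)
  rw [matLogb_eq_hermCalc h, matLogb_eq_hermCalc h',
    hermCalc_eq_aeval h (p := p) (fun i => hp _ (by simp [eigSet])),
    hermCalc_eq_aeval h' (p := p) (fun i => hp _ (by simp [eigSet])), hπ.map_aeval hA]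

lemma IsStarSurjection.map_isMinProjOf (hπ : IsStarSurjection X Y π) {p : Matrix α α ℂ}
    (hp : IsMinProjOf X p) (h0 : π p ≠ 0) : IsMinProjOf Y (π p) := by
  have hP := hπ.map_isProjn hp.1 hp.2.1
  refine ⟨hπ.maps _ hp.1, hP, h0, fun q hqY hq hqp => ?_⟩
  obtain ⟨b, hb, rfl⟩ := hπ.surj q hqY
  obtain ⟨c, hc⟩ := hp.exists_corner_eq_smul hb
  have hqc : π b = c • π p := by
    rw [← LinearMap.map_smul, ← hc, hπ.map_mul _ (mul_mem hp.1 hb) _ hp.1,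
      hπ.map_mul _ hp.1 _ hb, hP.mul_comm_of_le hq hqp, hqp]
  have hsq := hq.2
  rw [hqc, smul_mul_smul_comm, hP.2] at hsq
  have hcc : c * c = c := smul_left_injective ℂ h0 hsq
  rcases eq_or_ne c 0 with hc0 | hc0
  · left
    rw [hqc, hc0, zero_smul]
  · right
    rw [hqc, mul_left_cancel₀ hc0 (hcc.trans (mul_one c).symm), one_smul]

lemma IsStarSurjection.trace_projn_mul (hπ : IsStarSurjection X Y π)
    (hτ : IsCanonicalTrace X τ) (hτ' : IsCanonicalTrace Y τ') :
    ∀ e ∈ X, IsProjn e → (∀ f ∈ X, IsProjn f → f * e = f → π f = 0 → f = 0) →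
      ∀ a ∈ X, τ' (π e * π a) = τ (e * a) := by
  refine projection_induction fun e heX he ih hker a ha => ?_
  rcases eq_or_ne e 0 with rfl | he0
  · simp
  obtain ⟨p, hp, hpe⟩ := exists_minProj_le e heX he he0
  have hpX := hp.1
  have hrest := ih (e - p) (sub_mem heX hpX) (he.sub hp.2.1 hpe)
    (by rw [sub_mul, he.2, hpe])
    (fun h => hp.2.2.1 (by simpa using h))
    (fun f hf hfp hfe hf0 => hker f hf hfp (by
      have hee : (e - p) * e = e - p := by rw [sub_mul, he.2, hpe]
      rw [← hfe, mul_assoc, hee]) hf0) a ha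
  obtain ⟨c, hc⟩ := hp.exists_corner_eq_smul ha
  have hcorner : τ (p * a) = c := by
    rw [← hp.2.1.2, mul_assoc, hτ.1 p hpX _ (mul_mem hpX ha), hc, LinearMap.map_smul, hτ.2.2 p hp]
    simp
  have hcorner' : τ' (π p * π a) = c := by
    have hπp := hπ.map_isMinProjOf hp fun h => hp.2.2.1 (hker p hpX hp.2.1 hpe h)
    rw [← hπp.2.1.2, mul_assoc, hτ'.1 _ hπp.1 _ (mul_mem hπp.1 (hπ.maps a ha)),
      ← hπ.map_mul _ hpX _ ha, ← hπ.map_mul _ (mul_mem hpX ha) _ hpX, hc, LinearMap.map_smul,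
      LinearMap.map_smul, hτ'.2.2 _ hπp]
    simp
  rw [map_sub, sub_mul, sub_mul, map_sub, map_sub, hcorner, hcorner'] at hrest
  simpa using hrest

/-- The entropy functional of a density is the same on a star subalgebra and on a quotient of it
through which the density factors. -/
lemma IsStarSurjection.trace_mul_matLogb (hπ : IsStarSurjection X Y π)
    (hτ : IsCanonicalTrace X τ) (hτ' : IsCanonicalTrace Y τ') {σ : Matrix α α ℂ}
    {r : Matrix β β ℂ} (hσ : σ ∈ X) (hpos : σ.PosSemidef) (hr : r ∈ Y)
    (hrel : ∀ a ∈ X, τ' (r * π a) = τ (σ * a)) :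
    τ' (r * matLogb r) = τ (σ * matLogb σ) := by
  have h := hpos.isHermitian
  have hsum : σ = ∑ x ∈ eigSet h, (x : ℂ) • eigProj h x := by
    rw [← hermCalc_eq_sum h (fun x => x), hermCalc_id]
  have hstep : ∀ a ∈ X, τ' (π σ * π a) = τ (σ * a) := by
    intro a ha
    rw [hsum, _root_.map_sum, Finset.sum_mul, _root_.map_sum, Finset.sum_mul, _root_.map_sum]
    refine Finset.sum_congr rfl fun x _ => ?_
    rw [LinearMap.map_smul, smul_mul_assoc, LinearMap.map_smul, smul_mul_assoc, LinearMap.map_smul]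
    rcases eq_or_ne (x : ℂ) 0 with hx | hx
    · rw [hx, zero_smul, zero_smul]
    congr 1
    refine hπ.trace_projn_mul hτ hτ' _ (eigProj_mem h hσ x) (isProjn_eigProj h x) ?_ a ha
    intro f hf hfp hfe hf0
    by_contra hne
    have hmul := (isProjn_eigProj h x).mul_comm_of_le hfp hfe
    have hσf : σ * f = (x : ℂ) • f := by
      rw [← hmul, ← mul_assoc, mul_eigProj, smul_mul_assoc]
    have hzero := hrel f hf
    rw [hf0, mul_zero, map_zero, hσf, LinearMap.map_smul, smul_eq_mul, eq_comm,
      mul_eq_zero] at hzero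
    have hle := hτ.one_le hf hfp hne
    rw [hzero.resolve_left hx] at hle
    exact absurd hle (by norm_num)
  have hreq : r = π σ := by
    have hd : star (r - π σ) ∈ Y := star_mem (sub_mem hr (hπ.maps σ hσ))
    obtain ⟨b, hb, hbd⟩ := hπ.surj _ hd
    have hz : star (r - π σ) = 0 := by
      refine hτ'.faithful hd ?_
      rw [star_star, ← hbd, sub_mul, map_sub, hrel b hb, hstep b hb, sub_self]
    rwa [star_eq_zero, sub_eq_zero] at hz
  have hlog : matLogb σ ∈ X := by
    rw [matLogb_eq_hermCalc h]
    exact hermCalc_mem h hσ _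
  rw [hreq, ← hπ.map_matLogb hσ h, hstep _ hlog]

end Transfer

section RelativeEntropy

variable {α β : Type*} [Fintype α] [DecidableEq α] [Fintype β] [DecidableEq β]

lemma sub_mul_le_log_mul {x y t : ℝ} (hx : 0 ≤ x) (hy : 0 ≤ y) (ht : 0 ≤ t)
    (h0 : y = 0 → x * t = 0) :
    (x - y) * t ≤ Real.log 2 * (x * (Real.logb 2 x - Real.logb 2 y) * t) := by
  have hlog2 : Real.log 2 ≠ 0 := (Real.log_pos one_lt_two).ne'
  have hlog : Real.log 2 * (x * (Real.logb 2 x - Real.logb 2 y) * t) =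
      x * (Real.log x - Real.log y) * t := by
    simp only [Real.logb]
    field_simp
  rw [hlog]
  rcases hy.eq_or_lt with rfl | hy
  · have := h0 rfl
    simp [this, mul_right_comm]
  rcases hx.eq_or_lt with rfl | hx
  · simpa using mul_nonneg hy.le ht
  refine mul_le_mul_of_nonneg_right ?_ ht
  have h := Real.log_le_sub_one_of_pos (div_pos hy hx)
  rw [Real.log_div hy.ne' hx.ne'] at h
  have := mul_le_mul_of_nonneg_left h hx.le
  rw [mul_sub x (y / x), mul_div_cancel₀ _ hx.ne'] at this
  linarith

lemma apply_hermCalc_mul_hermCalc (τ : Matrix α α ℂ →ₗ[ℂ] ℂ) {A B : Matrix α α ℂ}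
    (hA : A.IsHermitian) (hB : B.IsHermitian) (f g : ℝ → ℝ) :
    (τ (hermCalc hA f * hermCalc hB g)).re =
      ∑ x ∈ eigSet hA, ∑ y ∈ eigSet hB, f x * g y * (τ (eigProj hA x * eigProj hB y)).re := by
  rw [hermCalc_eq_sum hA f, hermCalc_eq_sum hB g, Finset.sum_mul_sum]
  simp only [map_sum, Complex.re_sum, smul_mul_smul_comm, LinearMap.map_smul, smul_eq_mul,
    ← Complex.ofReal_mul, Complex.re_ofReal_mul]

/-- Klein's inequality for the canonical trace of a star subalgebra. -/
lemma IsCanonicalTrace.klein {X : StarSubalgebra ℂ (Matrix α α ℂ)} {τ : Matrix α α ℂ →ₗ[ℂ] ℂ}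
    (hτ : IsCanonicalTrace X τ) {A B : Matrix α α ℂ} (hA : A ∈ X) (hB : B ∈ X)
    (hApos : A.PosSemidef) (hBpos : B.PosSemidef)
    (hker : A * eigProj hBpos.isHermitian 0 = 0) :
    (τ A).re - (τ B).re ≤ Real.log 2 * (τ (A * (matLogb A - matLogb B))).re := by
  have hAh := hApos.isHermitian
  have hBh := hBpos.isHermitian
  have e₁ : A = hermCalc hAh (fun x => x) * hermCalc hBh (fun _ => 1) := by
    rw [hermCalc_id, hermCalc_one, mul_one]
  have e₂ : B = hermCalc hAh (fun _ => 1) * hermCalc hBh (fun x => x) := by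
    rw [hermCalc_id, hermCalc_one, one_mul]
  have e₃ : A * (matLogb A - matLogb B) =
      hermCalc hAh (fun x => x * Real.logb 2 x) * hermCalc hBh (fun _ => 1) -
        hermCalc hAh (fun x => x) * hermCalc hBh (Real.logb 2) := by
    rw [← hermCalc_mul hAh (fun x => x) (Real.logb 2), hermCalc_id, hermCalc_one, mul_one, mul_sub,
      matLogb_eq_hermCalc hAh, matLogb_eq_hermCalc hBh]
  have t₁ := (congrArg (fun M => (τ M).re) e₁).trans (apply_hermCalc_mul_hermCalc τ hAh hBh _ _)
  have t₂ := (congrArg (fun M => (τ M).re) e₂).trans (apply_hermCalc_mul_hermCalc τ hAh hBh _ _)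
  rw [t₁, t₂, e₃, map_sub, Complex.sub_re, apply_hermCalc_mul_hermCalc,
    apply_hermCalc_mul_hermCalc, ← Finset.sum_sub_distrib, ← Finset.sum_sub_distrib,
    Finset.mul_sum]
  refine Finset.sum_le_sum fun x hx => ?_
  rw [← Finset.sum_sub_distrib, ← Finset.sum_sub_distrib, Finset.mul_sum]
  refine Finset.sum_le_sum fun y hy => ?_
  have ht := hτ.mul_projn_nonneg (eigProj_mem hAh hA x) (eigProj_mem hBh hB y)
    (isProjn_eigProj hAh x) (isProjn_eigProj hBh y)
  have hz : y = 0 → x * (τ (eigProj hAh x * eigProj hBh y)).re = 0 := by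
    rintro rfl
    have hcomm : eigProj hAh x * A = (x : ℂ) • eigProj hAh x := by
      have := congrArg conjTranspose (mul_eigProj hAh x)
      rwa [conjTranspose_mul, conjTranspose_smul, (isProjn_eigProj hAh x).1.eq, hAh.eq,
        Complex.star_def, Complex.conj_ofReal] at this
    rw [← Complex.re_ofReal_mul, ← smul_eq_mul, ← LinearMap.map_smul, ← smul_mul_assoc, ← hcomm,
      mul_assoc, hker, mul_zero, map_zero, Complex.zero_re]
  have := sub_mul_le_log_mul (eigSet_nonneg hApos hx) (eigSet_nonneg hBpos hy)
    (Complex.le_def.1 ht).1 hz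
  calc _ = (x - y) * (τ (eigProj hAh x * eigProj hBh y)).re := by ring
    _ ≤ _ := this
    _ = _ := by ring

/-- The indicator function of the nonzero reals. -/
noncomputable def nonzeroIndicator (x : ℝ) : ℝ := if x = 0 then 0 else 1

lemma hermCalc_kronecker {A : Matrix α α ℂ} {B : Matrix β β ℂ} (hA : A.IsHermitian)
    (hB : B.IsHermitian) (f g : ℝ → ℝ) :
    hermCalc hA f ⊗ₖ hermCalc hB g =
      ((hA.eigenvectorUnitary : Matrix α α ℂ) ⊗ₖ (hB.eigenvectorUnitary : Matrix β β ℂ)) *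
        diagonal (fun i : α × β => ((f (hA.eigenvalues i.1) * g (hB.eigenvalues i.2) : ℝ) : ℂ)) *
        star ((hA.eigenvectorUnitary : Matrix α α ℂ) ⊗ₖ
          (hB.eigenvectorUnitary : Matrix β β ℂ)) := by
  simp only [hermCalc, mul_kronecker_mul, diagonal_kronecker_diagonal, star_eq_conjTranspose,
    conjTranspose_kronecker, Complex.ofReal_mul]

lemma matLogb_kronecker {A : Matrix α α ℂ} {B : Matrix β β ℂ} (hA : A.IsHermitian)
    (hB : B.IsHermitian) :
    matLogb (A ⊗ₖ B) = matLogb A ⊗ₖ hermCalc hB nonzeroIndicator +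
      hermCalc hA nonzeroIndicator ⊗ₖ matLogb B := by
  have hAB : (A ⊗ₖ B).IsHermitian := by
    rw [IsHermitian, conjTranspose_kronecker, hA.eq, hB.eq]
  have hdec := hermCalc_kronecker hA hB (fun x => x) (fun x => x)
  rw [hermCalc_id, hermCalc_id] at hdec
  rw [matLogb_eq_hermCalc hA, matLogb_eq_hermCalc hB, matLogb_eq_hermCalc hAB,
    hermCalc_kronecker, hermCalc_kronecker, hermCalc_eq_conj_diagonal hAB _ _ _ hdec, ← add_mul,
    ← mul_add, diagonal_add]
  · congr 3
    ext i
    rw [← Complex.ofReal_add]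
    congr 1
    simp only [nonzeroIndicator]
    by_cases h₁ : hA.eigenvalues i.1 = 0
    · simp [h₁]
    by_cases h₂ : hB.eigenvalues i.2 = 0
    · simp [h₂]
    simp [h₁, h₂, Real.logb_mul]
  · rw [star_eq_conjTranspose, conjTranspose_kronecker, ← mul_kronecker_mul,
      ← star_eq_conjTranspose, ← star_eq_conjTranspose, star_mul_eigenvectorUnitary,
      star_mul_eigenvectorUnitary, one_kronecker_one]
  · rw [star_eq_conjTranspose, conjTranspose_kronecker, ← mul_kronecker_mul,
      ← star_eq_conjTranspose, ← star_eq_conjTranspose, eigenvectorUnitary_mul_star,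
      eigenvectorUnitary_mul_star, one_kronecker_one]

lemma hermCalc_nonzeroIndicator_eq {A : Matrix α α ℂ} (h : A.IsHermitian) :
    hermCalc h (fun x => x⁻¹) * A = hermCalc h nonzeroIndicator := by
  calc _ = hermCalc h (fun x => x⁻¹) * hermCalc h (fun x => x) := by rw [hermCalc_id]
    _ = _ := by
      rw [hermCalc_mul]
      refine hermCalc_congr h fun i => ?_
      by_cases hi : h.eigenvalues i = 0 <;> simp [nonzeroIndicator, hi]

lemma mul_one_sub_hermCalc_nonzeroIndicator {A : Matrix α α ℂ} (h : A.IsHermitian) :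
    A * (1 - hermCalc h nonzeroIndicator) = 0 := by
  calc _ = A - hermCalc h (fun x => x) * hermCalc h nonzeroIndicator := by
        rw [hermCalc_id, mul_sub, mul_one]
    _ = A - hermCalc h (fun x => x) := by
      rw [hermCalc_mul]
      congr 1
      refine hermCalc_congr h fun i => ?_
      by_cases hi : h.eigenvalues i = 0 <;> simp [nonzeroIndicator, hi]
    _ = 0 := by rw [hermCalc_id, sub_self]

lemma isProjn_one_sub_hermCalc_nonzeroIndicator {A : Matrix α α ℂ} (h : A.IsHermitian) :
    IsProjn (1 - hermCalc h nonzeroIndicator) := by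
  refine IsProjn.sub ⟨isHermitian_one, one_mul 1⟩ ⟨isHermitian_hermCalc h _, ?_⟩ (mul_one _)
  rw [hermCalc_mul]
  exact hermCalc_congr h fun i => by simp [nonzeroIndicator]

lemma IsCanonicalTrace.mul_projn_eq_zero {X : StarSubalgebra ℂ (Matrix α α ℂ)}
    {τ : Matrix α α ℂ →ₗ[ℂ] ℂ} (hτ : IsCanonicalTrace X τ) {A e : Matrix α α ℂ} (hA : A ∈ X)
    (hpos : A.PosSemidef) (he : e ∈ X) (hp : IsProjn e) (h0 : τ (A * e) = 0) : A * e = 0 := by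
  have hz : e * A * e = 0 := by
    refine hτ.eq_zero_of_posSemidef (mul_mem (mul_mem he hA) he) ?_ ?_
    · have := hpos.conjTranspose_mul_mul_same e
      rwa [hp.1.eq] at this
    · rw [hτ.1 _ (mul_mem he hA) e he, ← mul_assoc, hp.2, hτ.1 e he A hA, h0]
  have hh := hpos.isHermitian
  have hsqrt : hermCalc hh Real.sqrt * hermCalc hh Real.sqrt = A := by
    rw [hermCalc_mul]
    refine (hermCalc_congr hh (g := fun x => x) fun i => ?_).trans (hermCalc_id hh)
    exact Real.mul_self_sqrt (hpos.eigenvalues_nonneg i)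
  have hse : hermCalc hh Real.sqrt * e = 0 := by
    rw [← conjTranspose_mul_self_eq_zero, conjTranspose_mul, hp.1.eq,
      (isHermitian_hermCalc hh _).eq, mul_assoc, ← mul_assoc (hermCalc hh Real.sqrt), hsqrt,
      ← mul_assoc, hz]
  calc A * e = hermCalc hh Real.sqrt * (hermCalc hh Real.sqrt * e) := by rw [← mul_assoc, hsqrt]
    _ = 0 := by rw [hse, mul_zero]

end RelativeEntropy

section TensorProduct

lemma sub_kronecker {l m n p : Type*} (A A' : Matrix l m ℂ) (B : Matrix n p ℂ) :
    (A - A') ⊗ₖ B = A ⊗ₖ B - A' ⊗ₖ B := by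
  ext
  simp [sub_mul]

lemma kronecker_sub {l m n p : Type*} (A : Matrix l m ℂ) (B B' : Matrix n p ℂ) :
    A ⊗ₖ (B - B') = A ⊗ₖ B - A ⊗ₖ B' := by
  ext
  simp [mul_sub]

variable {α β : Type*} [Fintype α] [DecidableEq α] [Fintype β] [DecidableEq β]

/-- The star subalgebra generated by the elementary tensors. -/
abbrev kroneckerAlgebra (X : StarSubalgebra ℂ (Matrix α α ℂ))
    (Y : StarSubalgebra ℂ (Matrix β β ℂ)) : StarSubalgebra ℂ (Matrix (α × β) (α × β) ℂ) :=
  StarAlgebra.adjoin ℂ {A | ∃ x ∈ X, ∃ y ∈ Y, A = x ⊗ₖ y}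

lemma kronecker_mem_kroneckerAlgebra {X : StarSubalgebra ℂ (Matrix α α ℂ)}
    {Y : StarSubalgebra ℂ (Matrix β β ℂ)} {x : Matrix α α ℂ} {y : Matrix β β ℂ} (hx : x ∈ X)
    (hy : y ∈ Y) : x ⊗ₖ y ∈ kroneckerAlgebra X Y :=
  StarAlgebra.subset_adjoin ℂ _ ⟨x, hx, y, hy, rfl⟩

lemma kroneckerAlgebra_induction {X : StarSubalgebra ℂ (Matrix α α ℂ)}
    {Y : StarSubalgebra ℂ (Matrix β β ℂ)} {P : Matrix (α × β) (α × β) ℂ → Prop}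
    (tensor : ∀ x ∈ X, ∀ y ∈ Y, P (x ⊗ₖ y)) (add : ∀ a b, P a → P b → P (a + b))
    {a : Matrix (α × β) (α × β) ℂ} (ha : a ∈ kroneckerAlgebra X Y) : P a := by
  have hclosure : a ∈ AddSubmonoid.closure
      {A : Matrix (α × β) (α × β) ℂ | ∃ x ∈ X, ∃ y ∈ Y, A = x ⊗ₖ y} := by
    induction ha using StarAlgebra.adjoin_induction with
    | mem a h => exact AddSubmonoid.subset_closure h
    | algebraMap r =>
      rw [Algebra.algebraMap_eq_smul_one, ← one_kronecker_one, ← smul_kronecker]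
      exact AddSubmonoid.subset_closure ⟨r • 1, X.smul_mem (one_mem X) r, 1, one_mem Y, rfl⟩
    | add a b _ _ ha hb => exact add_mem ha hb
    | mul a b _ _ ha hb =>
      have hmul := AddSubmonoid.mul_mem_mul ha hb
      rw [AddSubmonoid.closure_mul_closure] at hmul
      refine AddSubmonoid.closure_mono ?_ hmul
      rintro _ ⟨_, ⟨x, hx, y, hy, rfl⟩, _, ⟨x', hx', y', hy', rfl⟩, rfl⟩
      exact ⟨x * x', mul_mem hx hx', y * y', mul_mem hy hy', (mul_kronecker_mul _ _ _ _).symm⟩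
    | star a _ ha =>
      refine AddSubmonoid.closure_induction
        (motive := fun b _ => star b ∈ AddSubmonoid.closure
          {A : Matrix (α × β) (α × β) ℂ | ∃ x ∈ X, ∃ y ∈ Y, A = x ⊗ₖ y}) ?_ ?_ ?_ ha
      · rintro _ ⟨x, hx, y, hy, rfl⟩
        exact AddSubmonoid.subset_closure
          ⟨star x, star_mem hx, star y, star_mem hy, conjTranspose_kronecker x y⟩
      · simp
      · intro a b _ _ ha hb
        rw [star_add]
        exact add_mem ha hb
  refine AddSubmonoid.closure_induction (motive := fun b _ => P b) ?_ ?_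
    (fun a b _ _ => add a b) hclosure
  · rintro _ ⟨x, hx, y, hy, rfl⟩
    exact tensor x hx y hy
  · simpa using tensor 0 (zero_mem X) 0 (zero_mem Y)

lemma IsProjn.kronecker {p : Matrix α α ℂ} {q : Matrix β β ℂ} (hp : IsProjn p)
    (hq : IsProjn q) : IsProjn (p ⊗ₖ q) :=
  ⟨by rw [IsHermitian, conjTranspose_kronecker, hp.1.eq, hq.1.eq],
    by rw [← mul_kronecker_mul, hp.2, hq.2]⟩

lemma exists_linearMap_fixing (X : StarSubalgebra ℂ (Matrix α α ℂ)) :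
    ∃ P : Matrix α α ℂ →ₗ[ℂ] Matrix α α ℂ, ∀ x ∈ X, P x = x := by
  obtain ⟨g, hg⟩ := LinearMap.exists_leftInverse_of_injective
    X.toSubalgebra.toSubmodule.subtype (Submodule.ker_subtype _)
  refine ⟨X.toSubalgebra.toSubmodule.subtype ∘ₗ g, fun x hx => ?_⟩
  exact congrArg Subtype.val (LinearMap.congr_fun hg ⟨x, hx⟩)

/-- For commuting star subalgebras, multiplication extends to the tensor product. -/
lemma exists_kroneckerAlgebra_surjection {X Y : StarSubalgebra ℂ (Matrix α α ℂ)}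
    (hXY : CompatibleAlg X Y) :
    ∃ π : Matrix (α × α) (α × α) ℂ →ₗ[ℂ] Matrix α α ℂ,
      IsStarSurjection (kroneckerAlgebra X Y) (X ⊔ Y) π ∧
        ∀ x ∈ X, ∀ y ∈ Y, π (x ⊗ₖ y) = x * y := by
  obtain ⟨P, hP⟩ := exists_linearMap_fixing X
  obtain ⟨Q, hQ⟩ := exists_linearMap_fixing Y
  let π : Matrix (α × α) (α × α) ℂ →ₗ[ℂ] Matrix α α ℂ :=
    TensorProduct.lift ((LinearMap.mul ℂ (Matrix α α ℂ)).compl₁₂ P Q) ∘ₗ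
      (kroneckerLinearEquiv α α α α ℂ).symm.toLinearMap
  have hπ : ∀ x ∈ X, ∀ y ∈ Y, π (x ⊗ₖ y) = x * y := by
    intro x hx y hy
    simp [π, hP x hx, hQ y hy]
  have hmaps : ∀ a ∈ kroneckerAlgebra X Y, π a ∈ X ⊔ Y := fun a ha =>
    kroneckerAlgebra_induction (P := fun a => π a ∈ X ⊔ Y)
      (fun x hx y hy => by
        rw [hπ x hx y hy]
        exact StarSubalgebra.mul_mem_sup hx hy)
      (fun a b ha hb => by rw [map_add]; exact add_mem ha hb) ha
  have hmul : ∀ a ∈ kroneckerAlgebra X Y, ∀ b ∈ kroneckerAlgebra X Y,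
      π (a * b) = π a * π b := fun a ha b hb =>
    kroneckerAlgebra_induction (P := fun a => π (a * b) = π a * π b)
      (fun x hx y hy =>
        kroneckerAlgebra_induction (P := fun b => π (x ⊗ₖ y * b) = π (x ⊗ₖ y) * π b)
          (fun x' hx' y' hy' => by
            rw [← mul_kronecker_mul, hπ _ (mul_mem hx hx') _ (mul_mem hy hy'), hπ x hx y hy,
              hπ x' hx' y' hy', mul_assoc, mul_assoc, ← mul_assoc x' y, hXY x' hx' y hy,
              mul_assoc])
          (fun a b ha hb => by rw [mul_add, map_add, ha, hb, map_add, mul_add]) hb)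
      (fun a b ha hb => by rw [add_mul, map_add, ha, hb, map_add, add_mul]) ha
  have hstar : ∀ a ∈ kroneckerAlgebra X Y, π (star a) = star (π a) := fun a ha =>
    kroneckerAlgebra_induction (P := fun a => π (star a) = star (π a))
      (fun x hx y hy => by
        have : star (x ⊗ₖ y) = star x ⊗ₖ star y := conjTranspose_kronecker x y
        rw [this, hπ _ (star_mem hx) _ (star_mem hy), hπ x hx y hy, star_mul,
          hXY _ (star_mem hx) _ (star_mem hy)])
      (fun a b ha hb => by rw [star_add, map_add, ha, hb, map_add, star_add]) ha
  have hone : π 1 = 1 := by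
    rw [← one_kronecker_one, hπ 1 (one_mem X) 1 (one_mem Y), one_mul]
  refine ⟨π, ⟨hmaps, ?_, hmul, hstar, hone⟩, hπ⟩
  let I : StarSubalgebra ℂ (Matrix α α ℂ) :=
    { carrier := {y | ∃ a ∈ kroneckerAlgebra X Y, π a = y}
      mul_mem' := by
        rintro _ _ ⟨a, ha, rfl⟩ ⟨b, hb, rfl⟩
        exact ⟨a * b, mul_mem ha hb, hmul a ha b hb⟩
      add_mem' := by
        rintro _ _ ⟨a, ha, rfl⟩ ⟨b, hb, rfl⟩
        exact ⟨a + b, add_mem ha hb, map_add π a b⟩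
      algebraMap_mem' := fun r => ⟨algebraMap ℂ _ r, algebraMap_mem _ r, by
        rw [Algebra.algebraMap_eq_smul_one, LinearMap.map_smul, hone,
          Algebra.algebraMap_eq_smul_one]⟩
      star_mem' := by
        rintro _ ⟨a, ha, rfl⟩
        exact ⟨star a, star_mem ha, hstar a ha⟩ }
  have hle : X ⊔ Y ≤ I := sup_le
    (fun x hx => ⟨x ⊗ₖ 1, kronecker_mem_kroneckerAlgebra hx (one_mem Y), by
      rw [hπ x hx 1 (one_mem Y), mul_one]⟩)
    (fun y hy => ⟨1 ⊗ₖ y, kronecker_mem_kroneckerAlgebra (one_mem X) hy, by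
      rw [hπ 1 (one_mem X) y hy, one_mul]⟩)
  exact fun y hy => hle hy

end TensorProduct

/-- for compatible unital *-subalgebras `𝔛₁, 𝔛₂` of `M_n(ℂ)`, the
mutual information `I_ρ(𝔛₁∧𝔛₂)` equals the relative entropy `D(σ‖σ₁⊗σ₂)` on the
tensor product `𝔛₁⊗𝔛₂` (realized inside `M_n(ℂ)⊗M_n(ℂ)` via the Kronecker
product), where `σ` is the state determined by
`(τ₁⊗τ₂)(σ·(x₁⊗x₂)) = Tr(ρ x₁ x₂)` and `σ₁, σ₂` are its marginals.  In
particular the relative entropy is finite (support containment holds) and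
`I_ρ(𝔛₁∧𝔛₂) ≥ 0`. -/
theorem mutual_information_eq_relative_entropy {n : ℕ}
    (ρ : Matrix (Fin n) (Fin n) ℂ) (hρ : MatState ρ)
    (𝔛₁ 𝔛₂ : StarSubalgebra ℂ (Matrix (Fin n) (Fin n) ℂ))
    (hcomp : CompatibleAlg 𝔛₁ 𝔛₂)
    (τ₁ τ₂ : Matrix (Fin n) (Fin n) ℂ →ₗ[ℂ] ℂ)
    (hτ₁ : IsCanonicalTrace 𝔛₁ τ₁) (hτ₂ : IsCanonicalTrace 𝔛₂ τ₂)
    (H1 H2 H12 : ℝ)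
    (hH1 : IsAlgEntropy 𝔛₁ ρ H1) (hH2 : IsAlgEntropy 𝔛₂ ρ H2)
    (hH12 : IsAlgEntropy (𝔛₁ ⊔ 𝔛₂) ρ H12)
    -- the tensor product algebra `𝔛₁ ⊗ 𝔛₂` inside `M_{n²}(ℂ)` and its canonical
    -- trace `τ₁ ⊗ τ₂`
    (T : StarSubalgebra ℂ (Matrix (Fin n × Fin n) (Fin n × Fin n) ℂ))
    (hT : T = StarAlgebra.adjoin ℂ
      {A | ∃ x₁ ∈ 𝔛₁, ∃ x₂ ∈ 𝔛₂, A = x₁ ⊗ₖ x₂})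
    (τT : Matrix (Fin n × Fin n) (Fin n × Fin n) ℂ →ₗ[ℂ] ℂ)
    (hτT : IsCanonicalTrace T τT)
    (hτTprod : ∀ x₁ ∈ 𝔛₁, ∀ x₂ ∈ 𝔛₂, τT (x₁ ⊗ₖ x₂) = τ₁ x₁ * τ₂ x₂)
    -- the state `σ` on `𝔛₁ ⊗ 𝔛₂` induced by `ρ`
    (σ : Matrix (Fin n × Fin n) (Fin n × Fin n) ℂ)
    (hσmem : σ ∈ T) (hσpos : σ.PosSemidef) (hσtr : τT σ = 1)
    (hσ : ∀ x₁ ∈ 𝔛₁, ∀ x₂ ∈ 𝔛₂,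
      τT (σ * (x₁ ⊗ₖ x₂)) = (ρ * (x₁ * x₂)).trace)
    -- the marginals `σ₁, σ₂`
    (σ₁ σ₂ : Matrix (Fin n) (Fin n) ℂ)
    (hσ₁mem : σ₁ ∈ 𝔛₁) (hσ₁pos : σ₁.PosSemidef)
    (hσ₁ : ∀ x₁ ∈ 𝔛₁, τ₁ (σ₁ * x₁) = τT (σ * (x₁ ⊗ₖ (1 : Matrix (Fin n) (Fin n) ℂ))))
    (hσ₂mem : σ₂ ∈ 𝔛₂) (hσ₂pos : σ₂.PosSemidef)
    (hσ₂ : ∀ x₂ ∈ 𝔛₂, τ₂ (σ₂ * x₂) = τT (σ * ((1 : Matrix (Fin n) (Fin n) ℂ) ⊗ₖ x₂))) :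
    (∀ v : Fin n × Fin n → ℂ, (σ₁ ⊗ₖ σ₂).mulVec v = 0 → σ.mulVec v = 0) ∧
    H1 + H2 - H12 = (τT (σ * (matLogb σ - matLogb (σ₁ ⊗ₖ σ₂)))).re ∧
    0 ≤ H1 + H2 - H12 := by
  subst hT
  obtain ⟨π, hπ, hπmul⟩ := exists_kroneckerAlgebra_surjection hcomp
  have h₁ := hσ₁pos.isHermitian
  have h₂ := hσ₂pos.isHermitian
  have one₁ : (1 : Matrix (Fin n) (Fin n) ℂ) ∈ 𝔛₁ := one_mem _
  have one₂ : (1 : Matrix (Fin n) (Fin n) ℂ) ∈ 𝔛₂ := one_mem _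
  have hlog₁ : matLogb σ₁ ∈ 𝔛₁ := by
    rw [matLogb_eq_hermCalc h₁]
    exact hermCalc_mem h₁ hσ₁mem _
  have hlog₂ : matLogb σ₂ ∈ 𝔛₂ := by
    rw [matLogb_eq_hermCalc h₂]
    exact hermCalc_mem h₂ hσ₂mem _
  have ent₁ : H1 = -(τ₁ (σ₁ * matLogb σ₁)).re := by
    obtain ⟨τ, r, hτ, hr, rfl⟩ := hH1
    rw [algEntropy, IsStarSurjection.id.trace_mul_matLogb hτ₁ hτ hσ₁mem hσ₁pos hr.1]
    intro a ha
    rw [LinearMap.id_apply, hr.2.2 a ha, hσ₁ a ha, hσ a ha 1 one₂, mul_one]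
  have ent₂ : H2 = -(τ₂ (σ₂ * matLogb σ₂)).re := by
    obtain ⟨τ, r, hτ, hr, rfl⟩ := hH2
    rw [algEntropy, IsStarSurjection.id.trace_mul_matLogb hτ₂ hτ hσ₂mem hσ₂pos hr.1]
    intro a ha
    rw [LinearMap.id_apply, hr.2.2 a ha, hσ₂ a ha, hσ 1 one₁ a ha, one_mul]
  have ent₁₂ : H12 = -(τT (σ * matLogb σ)).re := by
    obtain ⟨τ, r, hτ, hr, rfl⟩ := hH12
    rw [algEntropy, hπ.trace_mul_matLogb hτT hτ hσmem hσpos hr.1]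
    intro a ha
    rw [hr.2.2 _ (hπ.maps a ha)]
    refine kroneckerAlgebra_induction (P := fun a => (ρ * π a).trace = τT (σ * a))
      (fun x hx y hy => by rw [hπmul x hx y hy, hσ x hx y hy])
      (fun a b ha hb => by rw [map_add, mul_add, trace_add, ha, hb, mul_add, map_add]) ha
  set s₁ := hermCalc h₁ nonzeroIndicator with hs₁
  set s₂ := hermCalc h₂ nonzeroIndicator with hs₂
  have ms₁ : s₁ ∈ 𝔛₁ := hermCalc_mem h₁ hσ₁mem _
  have ms₂ : s₂ ∈ 𝔛₂ := hermCalc_mem h₂ hσ₂mem _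
  have supp₁ : σ * (s₁ ⊗ₖ 1) = σ := by
    have hm : 1 - s₁ ∈ 𝔛₁ := sub_mem one₁ ms₁
    have hp := isProjn_one_sub_hermCalc_nonzeroIndicator h₁
    have hz := hτT.mul_projn_eq_zero hσmem hσpos (kronecker_mem_kroneckerAlgebra hm one₂)
      (hp.kronecker ⟨isHermitian_one, one_mul 1⟩)
      (by rw [← hσ₁ _ hm, mul_one_sub_hermCalc_nonzeroIndicator, map_zero])
    rwa [sub_kronecker, one_kronecker_one, mul_sub, mul_one, sub_eq_zero, eq_comm] at hz
  have supp₂ : σ * (1 ⊗ₖ s₂) = σ := by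
    have hm : 1 - s₂ ∈ 𝔛₂ := sub_mem one₂ ms₂
    have hp := isProjn_one_sub_hermCalc_nonzeroIndicator h₂
    have hz := hτT.mul_projn_eq_zero hσmem hσpos (kronecker_mem_kroneckerAlgebra one₁ hm)
      (IsProjn.kronecker ⟨isHermitian_one, one_mul 1⟩ hp)
      (by rw [← hσ₂ _ hm, mul_one_sub_hermCalc_nonzeroIndicator, map_zero])
    rwa [kronecker_sub, one_kronecker_one, mul_sub, mul_one, sub_eq_zero, eq_comm] at hz
  have factor : σ = σ * (hermCalc h₁ (fun x => x⁻¹) ⊗ₖ hermCalc h₂ (fun x => x⁻¹)) *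
      (σ₁ ⊗ₖ σ₂) := by
    rw [mul_assoc, ← mul_kronecker_mul, hermCalc_nonzeroIndicator_eq,
      hermCalc_nonzeroIndicator_eq, ← hs₁, ← hs₂]
    calc σ = σ * (s₁ ⊗ₖ 1) * (1 ⊗ₖ s₂) := by rw [supp₁, supp₂]
      _ = _ := by rw [mul_assoc, ← mul_kronecker_mul, mul_one, one_mul]
  have hlog : σ * matLogb (σ₁ ⊗ₖ σ₂) = σ * (matLogb σ₁ ⊗ₖ 1) + σ * (1 ⊗ₖ matLogb σ₂) := by
    rw [matLogb_kronecker h₁ h₂, mul_add, ← hs₁, ← hs₂]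
    congr 1
    · calc _ = σ * (1 ⊗ₖ s₂) * (matLogb σ₁ ⊗ₖ 1) := by
            rw [mul_assoc, ← mul_kronecker_mul, mul_one, one_mul]
        _ = _ := by rw [supp₂]
    · calc _ = σ * (s₁ ⊗ₖ 1) * (1 ⊗ₖ matLogb σ₂) := by
            rw [mul_assoc, ← mul_kronecker_mul, mul_one, one_mul]
        _ = _ := by rw [supp₁]
  have main : H1 + H2 - H12 = (τT (σ * (matLogb σ - matLogb (σ₁ ⊗ₖ σ₂)))).re := by
    rw [mul_sub, hlog, map_sub, map_add, ← hσ₁ _ hlog₁, ← hσ₂ _ hlog₂, ent₁, ent₂, ent₁₂,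
      Complex.sub_re, Complex.add_re]
    ring
  refine ⟨fun v hv => ?_, main, ?_⟩
  · rw [factor, ← mulVec_mulVec, hv, mulVec_zero]
  · have hpos := hσ₁pos.kronecker hσ₂pos
    have hker : σ * eigProj hpos.isHermitian 0 = 0 := by
      rw [factor, mul_assoc, mul_eigProj]
      simp
    have tr₁ : τ₁ σ₁ = 1 := by
      have := hσ₁ 1 one₁
      rwa [mul_one, one_kronecker_one, mul_one, hσtr] at this
    have tr₂ : τ₂ σ₂ = 1 := by
      have := hσ₂ 1 one₂
      rwa [mul_one, one_kronecker_one, mul_one, hσtr] at this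
    have := hτT.klein hσmem (kronecker_mem_kroneckerAlgebra hσ₁mem hσ₂mem) hσpos hpos hker
    rw [hσtr, hτTprod _ hσ₁mem _ hσ₂mem, tr₁, tr₂, mul_one, sub_self] at this
    rw [main]
    exact nonneg_of_mul_nonneg_right this (Real.log_pos one_lt_two)
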